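/- For every integer n ≥ 1, the number of symplectic Dellac configurations of size 2n satisfies #SpDC_{2n} = Σ_{f ∈ SP_n} 2^{ndf(f)}, the sum ranging over all surjective pistols f of size n. -/

import Mathlib

/-- A Dellac configuration of size `m`. -/
def IsDellac (m : ℕ) (D : Finset (ℕ × ℕ)) : Prop :=
  (∀ d ∈ D, 1 ≤ d.1 ∧ d.1 ≤ m ∧ 1 ≤ d.2 ∧ d.2 ≤ 2 * m) ∧
  (∀ i, 1 ≤ i → i ≤ 2 * m → (D.filter (fun d => d.2 = i)).card = 1) ∧
  (∀ j, 1 ≤ j → j ≤ m → (D.filter (fun d => d.1 = j)).card = 2) ∧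
  (∀ d ∈ D, d.1 ≤ d.2 ∧ d.2 ≤ d.1 + m)

/-- A symplectic Dellac configuration of size `2n`. -/
def IsSpDC (n : ℕ) (S : Finset (ℕ × ℕ)) : Prop :=
  IsDellac (2 * n) S ∧
  ∀ j i, 1 ≤ j → j ≤ 2 * n → 1 ≤ i → i ≤ 4 * n →
    ((j, i) ∈ S ↔ (2 * n + 1 - j, 4 * n + 1 - i) ∈ S)

/-- The set of symplectic Dellac configurations of size `2n`. -/
def SpDC (n : ℕ) : Set (Finset (ℕ × ℕ)) := {S | IsSpDC n S}

/-- A surjective pistol of size `n`: a surjective map `f : [1, 2n] → {2, 4, …, 2n}`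
with `f(j) ≥ j`, encoded as a function `ℕ → ℕ` vanishing outside `[1, 2n]`. -/
def IsSP (n : ℕ) (f : ℕ → ℕ) : Prop :=
  (∀ j, 1 ≤ j → j ≤ 2 * n → Even (f j) ∧ 2 ≤ f j ∧ f j ≤ 2 * n ∧ j ≤ f j) ∧
  (∀ v, Even v → 2 ≤ v → v ≤ 2 * n → ∃ j, 1 ≤ j ∧ j ≤ 2 * n ∧ f j = v) ∧
  (∀ j, j = 0 ∨ 2 * n < j → f j = 0)

/-- The set `SP_n` of surjective pistols of size `n`. -/
def SP (n : ℕ) : Set (ℕ → ℕ) := {f | IsSP n f}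

/-- `j` is a doubled fixed point of `f`: `f(j) = j` and `f(j') = j` for some `j' < j`. -/
def IsDFP (f : ℕ → ℕ) (j : ℕ) : Prop := f j = j ∧ ∃ j' < j, f j' = j

/-- `ndf(f)`: the number of elements of `{2, 4, …, 2n}` that are not doubled fixed
points of `f` (only elements of `{2, 4, …, 2n-2}` may count as doubled fixed points). -/
noncomputable def ndf (n : ℕ) (f : ℕ → ℕ) : ℕ :=
  {i : ℕ | 1 ≤ i ∧ i ≤ n ∧ ¬ (i < n ∧ IsDFP f (2 * i))}.ncard

/-- Moments of the weight of the continuous dual Hahn polynomials, in the variable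
`2 t² + 1/8` and normalised to have total mass one. -/
def dualHahnMoment : ℕ → ℚ → ℚ → ℚ → ℚ
  | 0, _, _, _ => 1
  | n + 1, a, b, c => 2 * (a + b) * (a + c) * dualHahnMoment n (a + 1) b c
      + (1 / 8 - 2 * a ^ 2) * dualHahnMoment n a b c

theorem dualHahnMoment_swap_right (n : ℕ) (a b c : ℚ) :
    dualHahnMoment n a b c = dualHahnMoment n a c b := by
  induction n generalizing a with
  | zero => rfl
  | succ n ih => simp only [dualHahnMoment]; rw [ih, ih a]; ring

theorem dualHahnMoment_swap_left_and_contiguous (n : ℕ) :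
    (∀ a b c, dualHahnMoment n a b c = dualHahnMoment n b a c) ∧
    ∀ a b c, (a + c) * dualHahnMoment n (a + 1) b c - (b + c) * dualHahnMoment n a (b + 1) c
      = (a - b) * dualHahnMoment n a b c := by
  induction n with
  | zero => exact ⟨fun _ _ _ => rfl, fun a b c => by simp only [dualHahnMoment]; ring⟩
  | succ n ih =>
    obtain ⟨hs, hc⟩ := ih
    have hs' : ∀ a b c, dualHahnMoment (n + 1) a b c = dualHahnMoment (n + 1) b a c := by
      intro a b c
      simp only [dualHahnMoment]
      rw [hs (b + 1) a c, hs b a c]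
      linear_combination 2 * (a + b) * hc a b c
    have hr : ∀ a b c, dualHahnMoment (n + 1) a b c = dualHahnMoment (n + 1) c a b := by
      intro a b c
      rw [dualHahnMoment_swap_right, hs']
    have hr' : ∀ a b c, dualHahnMoment n a b c = dualHahnMoment n c a b := by
      intro a b c
      rw [dualHahnMoment_swap_right, hs]
    refine ⟨hs', fun a b c => ?_⟩
    rw [hr (a + 1), hr a (b + 1), hr a b]
    simp only [dualHahnMoment]
    have h₁ := hc a b (c + 1)
    have h₂ := hc a b c
    rw [hr' (a + 1), hr' a (b + 1), hr' a b] at h₁ h₂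
    linear_combination 2 * (c + a) * (c + b) * h₁ + (1 / 8 - 2 * c ^ 2) * h₂

theorem dualHahnMoment_swap_left (n : ℕ) (a b c : ℚ) :
    dualHahnMoment n a b c = dualHahnMoment n b a c :=
  (dualHahnMoment_swap_left_and_contiguous n).1 a b c

/-- Sum over subsets of `range n` of a product of weights that depend on the number of
smaller elements of the subset. -/
def subsetSum (u d : ℕ → ℚ) (n : ℕ) : ℚ :=
  ∑ E ∈ (Finset.range n).powerset, ∏ l ∈ Finset.range n,
    if l ∈ E then u ((Finset.range l).filter (· ∈ E)).card
    else d ((Finset.range l).filter (· ∈ E)).card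

theorem subsetSum_eq_of_recurrence (u d : ℕ → ℚ) (N : ℕ → ℕ → ℚ) (h₀ : ∀ x, N 0 x = 1)
    (hN : ∀ m x, N (m + 1) x = u x * N m (x + 1) + d x * N m x) (n : ℕ) :
    subsetSum u d n = N n 0 := by
  have key : ∀ m, ∑ E ∈ (Finset.range n).powerset, (∏ l ∈ Finset.range n,
      if l ∈ E then u ((Finset.range l).filter (· ∈ E)).card
      else d ((Finset.range l).filter (· ∈ E)).card) * N m E.card = N (n + m) 0 := by
    induction n with
    | zero => intro m; simp
    | succ n ih =>
      intro m
      rw [Finset.range_add_one, Finset.sum_powerset_insert (by simp), ← Finset.sum_add_distrib,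
        show n + 1 + m = n + (m + 1) by ring, ← ih (m + 1)]
      refine Finset.sum_congr rfl fun E hE => ?_
      have hE' := Finset.mem_powerset.1 hE
      have hn : n ∉ E := fun h => by simpa using hE' h
      have hf : (Finset.range n).filter (· ∈ E) = E := by
        ext x; simp only [Finset.mem_filter]; exact ⟨fun h => h.2, fun h => ⟨hE' h, h⟩⟩
      have hf' : ∀ l ≤ n, (Finset.range l).filter (· ∈ insert n E)
          = (Finset.range l).filter (· ∈ E) := by
        intro l hl
        refine Finset.filter_congr fun x hx => ?_
        have : x ≠ n := by have := Finset.mem_range.1 hx; omega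
        simp [this]
      rw [Finset.prod_insert (by simp), Finset.prod_insert (by simp), if_neg hn,
        if_pos (Finset.mem_insert_self _ _), hf' n le_rfl, hf, Finset.card_insert_of_notMem hn, hN]
      have : ∏ l ∈ Finset.range n, (if l ∈ insert n E then
            u ((Finset.range l).filter (· ∈ insert n E)).card
            else d ((Finset.range l).filter (· ∈ insert n E)).card)
          = ∏ l ∈ Finset.range n, (if l ∈ E then u ((Finset.range l).filter (· ∈ E)).card
            else d ((Finset.range l).filter (· ∈ E)).card) := by
        refine Finset.prod_congr rfl fun l hl => ?_
        have hl := Finset.mem_range.1 hl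
        rw [hf' l hl.le]
        have : l ≠ n := hl.ne
        simp [this]
      rw [this]
      ring
  have := key 0
  simpa [h₀, subsetSum] using this

theorem subsetSum_dellac_eq_pistol (n : ℕ) (hn : 1 ≤ n) :
    subsetSum (fun x => (x + 1) * (x + 2)) (fun x => -(x * (x + 1) / 2)) n
      = 2 * subsetSum (fun x => (1 + 2 * x) * (x + 1)) (fun x => (1 - 2 * x) * x) n := by
  have hA := subsetSum_eq_of_recurrence (fun x => (x + 1) * (x + 2)) (fun x => -(x * (x + 1) / 2))
    (fun n x => dualHahnMoment n (x / 2 + 1 / 4) (x / 2 + 3 / 4) (3 / 4)) (fun _ => rfl)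
    (fun m x => by
      simp only [dualHahnMoment]
      rw [dualHahnMoment_swap_left m ((x : ℚ) / 2 + 1 / 4 + 1)]
      push_cast
      ring_nf) n
  have hB := subsetSum_eq_of_recurrence (fun x => (1 + 2 * x) * (x + 1)) (fun x => (1 - 2 * x) * x)
    (fun n x => dualHahnMoment n (x - 1 / 4) (3 / 4) (5 / 4)) (fun _ => rfl)
    (fun m x => by
      simp only [dualHahnMoment]
      push_cast
      ring_nf) n
  rw [hA, hB]
  obtain ⟨m, rfl⟩ : ∃ m, n = m + 1 := ⟨n - 1, by omega⟩
  simp only [dualHahnMoment]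
  rw [dualHahnMoment_swap_right m (((0 : ℕ) : ℚ) - 1 / 4 + 1), dualHahnMoment_swap_left m (_ + 1)]
  norm_num

/-- The contribution of the position `2 n - k` and of its value `2 (n - v)` in the expansion
indexed by the set `E` of values that may be taken at non-fixed positions. -/
def pistolWeight (E : Finset ℕ) (k v : ℕ) : ℚ :=
  if k = 2 * v then 1
  else if v ∈ E then (if k % 2 = 0 then (if k / 2 ∈ E then 2 else -2) else 1) else 0

/-- The contribution of the value `2 (n - l)` of the map sending `2 n - k` to
`2 (n - g k)`: it is `0` if the value is missed, `1` if it is a doubled fixed point,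
and `2` otherwise. -/
noncomputable def valueWeight (n : ℕ) (g : ℕ → ℕ) (l : ℕ) : ℚ :=
  open Classical in
  if g (2 * l) = l then (if ∃ k < 2 * n, k ≠ 2 * l ∧ g k = l then 1 else 2)
  else (if ∃ k < 2 * n, k ≠ 2 * l ∧ g k = l then 2 else 0)

theorem prod_range_two_mul {M : Type*} [CommMonoid M] (f : ℕ → M) (n : ℕ) :
    ∏ k ∈ Finset.range (2 * n), f k = ∏ l ∈ Finset.range n, f (2 * l) * f (2 * l + 1) := by
  induction n with
  | zero => simp
  | succ n ih =>
    rw [show 2 * (n + 1) = 2 * n + 1 + 1 by ring, Finset.prod_range_succ, Finset.prod_range_succ,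
      ih, Finset.prod_range_succ, mul_assoc]

theorem prod_valueWeight (n : ℕ) (g : ℕ → ℕ) (hg : ∀ k < 2 * n, g k ≤ k / 2) :
    ∏ l ∈ Finset.range n, valueWeight n g l
      = ∑ E ∈ (Finset.range n).powerset, ∏ k ∈ Finset.range (2 * n), pistolWeight E k (g k) := by
  classical
  have hw : ∀ l ∈ Finset.range n, valueWeight n g l = (if g (2 * l) = l then 1 else 2)
      + (if g (2 * l) = l then 1 else -2) * (if ∃ k < 2 * n, k ≠ 2 * l ∧ g k = l then 0 else 1) := by
    intro l _
    unfold valueWeight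
    split_ifs <;> norm_num
  rw [Finset.prod_congr rfl hw, Finset.prod_add]
  refine Finset.sum_congr rfl fun E hE => ?_
  have hE := Finset.mem_powerset.1 hE
  by_cases hbad : ∃ k < 2 * n, k ≠ 2 * g k ∧ g k ∉ E
  · obtain ⟨k, hk, hk2, hkE⟩ := hbad
    have hex : ∃ k' < 2 * n, k' ≠ 2 * g k ∧ g k' = g k := ⟨k, hk, hk2, rfl⟩
    have hmem : g k ∈ Finset.range n \ E := by
      have := hg k hk
      rw [Finset.mem_sdiff, Finset.mem_range]
      exact ⟨by omega, hkE⟩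
    rw [Finset.prod_eq_zero hmem (by rw [if_pos hex, mul_zero]), mul_zero,
      Finset.prod_eq_zero (Finset.mem_range.2 hk) (by rw [pistolWeight, if_neg hk2, if_neg hkE])]
  · push Not at hbad
    have h₁ : ∏ l ∈ Finset.range n \ E, ((if g (2 * l) = l then (1 : ℚ) else -2)
          * (if ∃ k < 2 * n, k ≠ 2 * l ∧ g k = l then 0 else 1))
        = ∏ l ∈ Finset.range n \ E, (if g (2 * l) = l then (1 : ℚ) else -2) := by
      refine Finset.prod_congr rfl fun l hl => ?_
      rw [if_neg (c := ∃ k < 2 * n, k ≠ 2 * l ∧ g k = l), mul_one]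
      rintro ⟨k, hk, hk2, rfl⟩
      exact (Finset.mem_sdiff.1 hl).2 (hbad k hk hk2)
    have h₂ : (∏ l ∈ E, if g (2 * l) = l then (1 : ℚ) else 2)
          * ∏ l ∈ Finset.range n \ E, (if g (2 * l) = l then (1 : ℚ) else -2)
        = ∏ l ∈ Finset.range n, if g (2 * l) = l then (1 : ℚ) else if l ∈ E then 2 else -2 := by
      rw [← Finset.prod_sdiff hE, mul_comm]
      congr 1
      · exact Finset.prod_congr rfl fun l hl => by simp [(Finset.mem_sdiff.1 hl).2]
      · exact Finset.prod_congr rfl fun l hl => by simp [hl]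
    rw [h₁, h₂, prod_range_two_mul]
    refine Finset.prod_congr rfl fun l hl => ?_
    have hl := Finset.mem_range.1 hl
    have h₃ := hbad (2 * l) (by omega)
    have h₄ := hbad (2 * l + 1) (by omega) (by omega)
    have h₅ : pistolWeight E (2 * l + 1) (g (2 * l + 1)) = 1 := by
      rw [pistolWeight, if_neg (by omega), if_pos h₄, if_neg (by omega)]
    rw [h₅, mul_one, pistolWeight]
    by_cases h : g (2 * l) = l
    · rw [if_pos h, if_pos (by omega)]
    · rw [if_neg h, if_neg (show ¬2 * l = 2 * g (2 * l) by omega),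
        if_pos (h₃ (by omega)), if_pos (show 2 * l % 2 = 0 by omega), show 2 * l / 2 = l by omega]

theorem sum_pistolWeight (E : Finset ℕ) (l : ℕ) :
    (∑ v ∈ Finset.range (2 * l / 2 + 1), pistolWeight E (2 * l) v)
      * (∑ v ∈ Finset.range ((2 * l + 1) / 2 + 1), pistolWeight E (2 * l + 1) v)
    = if l ∈ E then (1 + 2 * (((Finset.range l).filter (· ∈ E)).card : ℚ))
          * (((Finset.range l).filter (· ∈ E)).card + 1)
      else (1 - 2 * (((Finset.range l).filter (· ∈ E)).card : ℚ))
          * ((Finset.range l).filter (· ∈ E)).card := by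
  rw [show 2 * l / 2 = l by omega, show (2 * l + 1) / 2 = l by omega]
  have h₁ : ∑ v ∈ Finset.range (l + 1), pistolWeight E (2 * l) v
      = 1 + (if l ∈ E then 2 else -2) * ((Finset.range l).filter (· ∈ E)).card := by
    rw [Finset.sum_range_succ, add_comm]
    congr 1
    · simp [pistolWeight]
    · rw [Finset.card_filter, Nat.cast_sum, Finset.mul_sum]
      refine Finset.sum_congr rfl fun v hv => ?_
      have := Finset.mem_range.1 hv
      rw [pistolWeight, if_neg (by omega), if_pos (show 2 * l % 2 = 0 by omega),
        show 2 * l / 2 = l by omega]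
      by_cases h : v ∈ E <;> simp [h]
  have h₂ : ∑ v ∈ Finset.range (l + 1), pistolWeight E (2 * l + 1) v
      = ((Finset.range l).filter (· ∈ E)).card + (if l ∈ E then 1 else 0) := by
    have h : ∀ v ∈ Finset.range (l + 1),
        pistolWeight E (2 * l + 1) v = if v ∈ E then (1 : ℚ) else 0 := by
      intro v _
      rw [pistolWeight, if_neg (by omega), if_neg (show ¬(2 * l + 1) % 2 = 0 by omega)]
    rw [Finset.sum_congr rfl h, Finset.sum_range_succ, Finset.card_filter, Nat.cast_sum]
    simp
  rw [h₁, h₂]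
  split_ifs <;> ring

/-- Extension of a function on `Fin m` by zero. -/
def zeroExtend {m : ℕ} (p : Fin m → ℕ) (k : ℕ) : ℕ := if h : k < m then p ⟨k, h⟩ else 0

theorem zeroExtend_val {m : ℕ} (p : Fin m → ℕ) (k : Fin m) : zeroExtend p k = p k := by
  simp [zeroExtend]

theorem sum_prod_valueWeight (n : ℕ) :
    ∑ p ∈ Fintype.piFinset (fun k : Fin (2 * n) => Finset.range ((k : ℕ) / 2 + 1)),
      ∏ l ∈ Finset.range n, valueWeight n (zeroExtend p) l
    = subsetSum (fun x => (1 + 2 * x) * (x + 1)) (fun x => (1 - 2 * x) * x) n := by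
  have h : ∀ p ∈ Fintype.piFinset (fun k : Fin (2 * n) => Finset.range ((k : ℕ) / 2 + 1)),
      ∏ l ∈ Finset.range n, valueWeight n (zeroExtend p) l
      = ∑ E ∈ (Finset.range n).powerset, ∏ k : Fin (2 * n), pistolWeight E k (p k) := by
    intro p hp
    rw [prod_valueWeight]
    · refine Finset.sum_congr rfl fun E _ => ?_
      rw [Finset.prod_range]
      simp only [zeroExtend_val]
    · intro k hk
      have := Fintype.mem_piFinset.1 hp ⟨k, hk⟩
      rw [Finset.mem_range] at this
      simp only [zeroExtend, dif_pos hk]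
      exact Nat.lt_succ_iff.1 this
  rw [Finset.sum_congr rfl h, Finset.sum_comm, subsetSum]
  refine Finset.sum_congr rfl fun E _ => ?_
  rw [← Finset.prod_univ_sum, ← Finset.prod_range (fun k => ∑ v ∈ Finset.range (k / 2 + 1),
    pistolWeight E k v), prod_range_two_mul]
  exact Finset.prod_congr rfl fun l _ => sum_pistolWeight E l

/-- The map on `[1, 2n]` sending `2 n - k` to `2 (n - p k)`. -/
def reversedPistol (n : ℕ) (p : Fin (2 * n) → ℕ) (j : ℕ) : ℕ :=
  if 1 ≤ j ∧ j ≤ 2 * n then 2 * (n - zeroExtend p (2 * n - j)) else 0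

theorem reversedPistol_apply (n : ℕ) (p : Fin (2 * n) → ℕ) {k : ℕ} (hk : k < 2 * n) :
    reversedPistol n p (2 * n - k) = 2 * (n - zeroExtend p k) := by
  rw [reversedPistol, if_pos (by omega), show 2 * n - (2 * n - k) = k by omega]

theorem two_pow_ndf (n : ℕ) (hn : 1 ≤ n) (p : Fin (2 * n) → ℕ)
    (hp : ∀ k < 2 * n, zeroExtend p k ≤ k / 2)
    (hsurj : ∀ l < n, ∃ k < 2 * n, zeroExtend p k = l) :
    (2 : ℚ) ^ ndf n (reversedPistol n p)
      = 2 * ∏ l ∈ Finset.range n, valueWeight n (zeroExtend p) l := by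
  classical
  set f := reversedPistol n p with hf
  set g := zeroExtend p with hg
  have hdfp : ∀ l < n, IsDFP f (2 * (n - l)) ↔
      g (2 * l) = l ∧ ∃ k < 2 * n, k ≠ 2 * l ∧ g k = l := by
    intro l hl
    have h₁ : f (2 * (n - l)) = 2 * (n - g (2 * l)) := by
      rw [show 2 * (n - l) = 2 * n - 2 * l by omega]
      exact reversedPistol_apply n p (by omega)
    have h₂ := hp (2 * l) (by omega)
    unfold IsDFP
    rw [h₁]
    refine and_congr (by omega) ⟨?_, ?_⟩
    · rintro ⟨j, hj, hjf⟩
      have hj1 : 1 ≤ j := by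
        by_contra h
        rw [hf, reversedPistol, if_neg (by omega)] at hjf
        omega
      have h₃ := reversedPistol_apply n p (k := 2 * n - j) (by omega)
      rw [← hf, ← hg, show 2 * n - (2 * n - j) = j by omega] at h₃
      have h₄ := hp (2 * n - j) (by omega)
      exact ⟨2 * n - j, by omega, by omega, by omega⟩
    · rintro ⟨k, hk, hkl, hgk⟩
      have h₃ := hp k hk
      have h₄ := reversedPistol_apply n p hk
      rw [← hf, ← hg] at h₄
      exact ⟨2 * n - k, by omega, by omega⟩
  have hval : ∀ l < n, valueWeight n g l = if IsDFP f (2 * (n - l)) then 1 else 2 := by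
    intro l hl
    unfold valueWeight
    by_cases h : g (2 * l) = l
    · by_cases h' : ∃ k < 2 * n, k ≠ 2 * l ∧ g k = l
      · rw [if_pos h, if_pos h', if_pos ((hdfp l hl).2 ⟨h, h'⟩)]
      · rw [if_pos h, if_neg h', if_neg fun hd => h' ((hdfp l hl).1 hd).2]
    · obtain ⟨k, hk, hkl⟩ := hsurj l hl
      rw [if_neg h, if_neg fun hd => h ((hdfp l hl).1 hd).1, if_pos]
      exact ⟨k, hk, by rintro rfl; exact h hkl, hkl⟩
  have h₀ : IsDFP f (2 * (n - 0)) := by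
    have h₁ := hp 0 (by omega)
    have h₂ := hp 1 (by omega)
    exact (hdfp 0 (by omega)).2 ⟨by simpa using h₁, 1, by omega, by omega, by omega⟩
  have hset : {i : ℕ | 1 ≤ i ∧ i ≤ n ∧ ¬ (i < n ∧ IsDFP f (2 * i))} =
      ((Finset.range n).filter fun l => l = 0 ∨ ¬ IsDFP f (2 * (n - l))).image (fun l => n - l) := by
    ext i
    simp only [Set.mem_ofPred_eq, Finset.coe_image, Set.mem_image, Finset.mem_coe,
      Finset.mem_filter, Finset.mem_range]
    constructor
    · rintro ⟨h1, h2, h3⟩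
      refine ⟨n - i, ⟨by omega, ?_⟩, by omega⟩
      rw [show n - (n - i) = i by omega]
      by_cases h : i < n
      · exact Or.inr fun hd => h3 ⟨h, hd⟩
      · exact Or.inl (by omega)
    · rintro ⟨l, ⟨hl, h⟩, rfl⟩
      refine ⟨by omega, by omega, ?_⟩
      rintro ⟨h1, h2⟩
      rcases h with rfl | h
      · omega
      · exact h h2
  have hndf : ndf n f = ((Finset.range n).filter fun l => l = 0 ∨ ¬ IsDFP f (2 * (n - l))).card := by
    rw [ndf, hset, Set.ncard_coe_finset, Finset.card_image_of_injOn]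
    intro a ha b hb hab
    simp only [Finset.coe_filter, Finset.mem_range, Set.mem_ofPred_eq] at ha hb hab
    omega
  rw [hndf, ← Finset.prod_const, Finset.prod_filter,
    Finset.prod_congr rfl fun l hl => hval l (Finset.mem_range.1 hl)]
  obtain ⟨m, rfl⟩ : ∃ m, n = m + 1 := ⟨n - 1, by omega⟩
  rw [Finset.prod_range_succ', Finset.prod_range_succ', if_pos (Or.inl rfl), if_pos h₀, mul_one,
    mul_comm]
  congr 1
  refine Finset.prod_congr rfl fun l _ => ?_
  simp

theorem finsum_two_pow_ndf (n : ℕ) (hn : 1 ≤ n) :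
    ((∑ᶠ f ∈ SP n, 2 ^ ndf n f : ℕ) : ℚ)
      = 2 * subsetSum (fun x => (1 + 2 * x) * (x + 1)) (fun x => (1 - 2 * x) * x) n := by
  classical
  set P := Fintype.piFinset (fun k : Fin (2 * n) => Finset.range ((k : ℕ) / 2 + 1)) with hP
  have hPle : ∀ p ∈ P, ∀ k < 2 * n, zeroExtend p k ≤ k / 2 := by
    intro p hp k hk
    have := Finset.mem_range.1 (Fintype.mem_piFinset.1 hp ⟨k, hk⟩)
    simp only [zeroExtend, dif_pos hk]
    exact Nat.lt_succ_iff.1 this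
  set Q := P.filter (fun p => ∀ l < n, ∃ k < 2 * n, zeroExtend p k = l) with hQ
  have hbij : Set.BijOn (reversedPistol n) Q (SP n) := by
    refine ⟨?_, ?_, ?_⟩
    · intro p hp
      obtain ⟨hpP, hps⟩ := Finset.mem_filter.1 (Finset.mem_coe.1 hp)
      refine ⟨?_, ?_, ?_⟩
      · intro j h1 h2
        have := hPle p hpP (2 * n - j) (by omega)
        rw [reversedPistol, if_pos ⟨h1, h2⟩]
        exact ⟨even_two_mul _, by omega, by omega, by omega⟩
      · intro v hv h1 h2
        obtain ⟨w, rfl⟩ := hv.two_dvd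
        obtain ⟨k, hk, hkw⟩ := hps (n - w) (by omega)
        refine ⟨2 * n - k, by omega, by omega, ?_⟩
        rw [reversedPistol_apply n p hk]
        omega
      · intro j hj
        rw [reversedPistol, if_neg (by omega)]
    · intro p hp q hq hpq
      have hpP := hPle p (Finset.mem_filter.1 (Finset.mem_coe.1 hp)).1
      have hqP := hPle q (Finset.mem_filter.1 (Finset.mem_coe.1 hq)).1
      funext k
      have h := congrFun hpq (2 * n - k)
      rw [reversedPistol_apply n p k.2, reversedPistol_apply n q k.2] at h
      have h1 := hpP k k.2
      have h2 := hqP k k.2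
      have h3 := k.2
      rw [← zeroExtend_val p, ← zeroExtend_val q]
      omega
    · rintro f ⟨hf1, hf2, hf3⟩
      set p : Fin (2 * n) → ℕ := fun k => n - f (2 * n - k) / 2 with hpdef
      have hext : ∀ k < 2 * n, zeroExtend p k = n - f (2 * n - k) / 2 := by
        intro k hk
        simp only [zeroExtend, dif_pos hk, hpdef]
      refine ⟨p, Finset.mem_coe.2 (Finset.mem_filter.2 ⟨?_, ?_⟩), ?_⟩
      · rw [hP, Fintype.mem_piFinset]
        intro k
        have hk := k.2
        obtain ⟨he, h1, h2, h3⟩ := hf1 (2 * n - k) (by omega) (by omega)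
        obtain ⟨w, hw⟩ := he.two_dvd
        rw [Finset.mem_range, hpdef]
        simp only
        omega
      · intro l hl
        obtain ⟨j, h1, h2, h3⟩ := hf2 (2 * (n - l)) (even_two_mul _) (by omega) (by omega)
        refine ⟨2 * n - j, by omega, ?_⟩
        rw [hext _ (by omega), show 2 * n - (2 * n - j) = j by omega, h3]
        omega
      · funext j
        by_cases hj : 1 ≤ j ∧ j ≤ 2 * n
        · obtain ⟨he, h1, h2, h3⟩ := hf1 j hj.1 hj.2
          rw [reversedPistol, if_pos hj, hext _ (by omega), show 2 * n - (2 * n - j) = j by omega]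
          obtain ⟨w, hw⟩ := he.two_dvd
          omega
        · rw [reversedPistol, if_neg hj, hf3 j (by omega)]
  rw [← finsum_mem_eq_of_bijOn (f := fun p => 2 ^ ndf n (reversedPistol n p))
    (reversedPistol n) hbij (fun _ _ => rfl), finsum_mem_coe_finset, ← sum_prod_valueWeight,
    Finset.mul_sum, Nat.cast_sum, hQ, Finset.sum_filter]
  refine Finset.sum_congr rfl fun p hp => ?_
  split_ifs with hs
  · rw [← two_pow_ndf n hn p (hPle p hp) hs]
    push_cast
    rfl
  · push Not at hs
    obtain ⟨l, hl, hl'⟩ := hs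
    rw [Finset.prod_eq_zero (Finset.mem_range.2 hl), mul_zero]
    rw [valueWeight, if_neg (hl' _ (by omega)), if_neg]
    rintro ⟨k, hk, -, h⟩
    exact hl' k hk h

open MvPolynomial in
/-- The sum of the first `t` variables. -/
noncomputable def partialSum (t : ℕ) : MvPolynomial ℕ ℚ := ∑ s ∈ Finset.range t, X s

/-- The exponent with the value `2` at each `s < t` and `0` elsewhere. -/
noncomputable def doubleExponent (t : ℕ) : ℕ →₀ ℕ := ∑ s ∈ Finset.range t, Finsupp.single s 2

theorem doubleExponent_apply (t s : ℕ) : doubleExponent t s = if s < t then 2 else 0 := by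
  simp [doubleExponent, Finsupp.finsetSum_apply, Finsupp.single_apply]

theorem partialSum_mem_supported {t t' : ℕ} (h : t ≤ t') :
    partialSum t ∈ MvPolynomial.supported ℚ (Set.Iio t') := by
  refine Subalgebra.sum_mem _ fun s hs => MvPolynomial.X_mem_supported.2 ?_
  have := Finset.mem_range.1 hs
  exact Set.mem_Iio.2 (by omega)

theorem coeff_eq_zero_of_mem_supported {t : ℕ} {P : MvPolynomial ℕ ℚ}
    (hP : P ∈ MvPolynomial.supported ℚ (Set.Iio t)) {e : ℕ →₀ ℕ} (he : e t ≠ 0) :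
    P.coeff e = 0 := by
  by_contra h
  refine he (MvPolynomial.mem_support_notMem_vars_zero (MvPolynomial.mem_support_iff.2 h) ?_)
  intro hv
  exact lt_irrefl t (MvPolynomial.mem_supported.1 hP hv)

theorem coeff_doubleExponent_X_pow_mul {t : ℕ} {P : MvPolynomial ℕ ℚ}
    (hP : P ∈ MvPolynomial.supported ℚ (Set.Iio t)) (j : ℕ) :
    (MvPolynomial.X t ^ j * P).coeff (doubleExponent (t + 1))
      = if j = 2 then P.coeff (doubleExponent t) else 0 := by
  have hd : doubleExponent (t + 1) = doubleExponent t + Finsupp.single t 2 :=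
    Finset.sum_range_succ _ _
  rw [MvPolynomial.X_pow_eq_monomial, MvPolynomial.coeff_monomial_mul', one_mul]
  split_ifs with h₁ h₂ h₂
  · rw [h₂, hd, add_tsub_cancel_right]
  · refine coeff_eq_zero_of_mem_supported hP ?_
    have := Finsupp.single_le_iff.1 h₁
    simp only [doubleExponent_apply, Finsupp.tsub_apply, Finsupp.single_eq_same] at this ⊢
    simp only [Nat.lt_succ_self, if_true] at this ⊢
    omega
  · exact absurd (Finsupp.single_le_iff.2 (by simp [doubleExponent_apply, h₂])) h₁
  · rfl

theorem coeff_partialSum_pow_mul {t : ℕ} {P : MvPolynomial ℕ ℚ}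
    (hP : P ∈ MvPolynomial.supported ℚ (Set.Iio t)) (f : ℕ) :
    (partialSum (t + 1) ^ f * P).coeff (doubleExponent (t + 1))
      = f.choose 2 * (partialSum t ^ (f - 2) * P).coeff (doubleExponent t) := by
  have hA : partialSum (t + 1) = MvPolynomial.X t + partialSum t := by
    rw [partialSum, Finset.sum_range_succ, add_comm]; rfl
  have hterm : ∀ j, (MvPolynomial.X t ^ j * partialSum t ^ (f - j) * (f.choose j : MvPolynomial ℕ ℚ) * P).coeff
      (doubleExponent (t + 1)) = if j = 2 then
        f.choose 2 * (partialSum t ^ (f - 2) * P).coeff (doubleExponent t) else 0 := by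
    intro j
    have hQ : partialSum t ^ (f - j) * P ∈ MvPolynomial.supported ℚ (Set.Iio t) :=
      Subalgebra.mul_mem _ (Subalgebra.pow_mem _ (partialSum_mem_supported le_rfl) _) hP
    rw [show MvPolynomial.X t ^ j * partialSum t ^ (f - j) * (f.choose j : MvPolynomial ℕ ℚ) * P
        = MvPolynomial.C (f.choose j : ℚ) * (MvPolynomial.X t ^ j * (partialSum t ^ (f - j) * P)) by
      rw [map_natCast]; ring, MvPolynomial.coeff_C_mul, coeff_doubleExponent_X_pow_mul hQ]
    split_ifs with h
    · rw [h]
    · rw [mul_zero]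
  rw [hA, add_pow, Finset.sum_mul, MvPolynomial.coeff_sum, Finset.sum_congr rfl fun j _ => hterm j,
    Finset.sum_ite_eq']
  split_ifs with h
  · rfl
  · rw [Nat.choose_eq_zero_of_lt (by rw [Finset.mem_range] at h; omega)]
    simp

theorem coeff_dellac_product (E : Finset ℕ) (t : ℕ) :
    (partialSum t ^ ((Finset.range t).filter (· ∈ E)).card * ∏ s ∈ Finset.range t,
      partialSum (s + 1) * (if s ∈ E then 2 else -partialSum s)).coeff (doubleExponent t)
    = ∏ l ∈ Finset.range t,
      if l ∈ E then ((((Finset.range l).filter (· ∈ E)).card : ℚ) + 1)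
          * (((Finset.range l).filter (· ∈ E)).card + 2)
      else -((((Finset.range l).filter (· ∈ E)).card : ℚ)
          * (((Finset.range l).filter (· ∈ E)).card + 1) / 2) := by
  induction t with
  | zero => simp [doubleExponent]
  | succ t ih =>
    have hR : ∏ s ∈ Finset.range t, partialSum (s + 1) * (if s ∈ E then 2 else -partialSum s)
        ∈ MvPolynomial.supported ℚ (Set.Iio t) := by
      refine Subalgebra.prod_mem _ fun s hs => ?_
      have hs := Finset.mem_range.1 hs
      refine Subalgebra.mul_mem _ (partialSum_mem_supported hs) ?_
      split_ifs
      · exact ofNat_mem _ 2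
      · exact Subalgebra.neg_mem _ (partialSum_mem_supported hs.le)
    rw [Finset.prod_range_succ, Finset.prod_range_succ, ← ih]
    set R := ∏ s ∈ Finset.range t, partialSum (s + 1) * (if s ∈ E then 2 else -partialSum s)
    set x := ((Finset.range t).filter (· ∈ E)).card with hx
    by_cases h : t ∈ E
    · have hc : ((Finset.range (t + 1)).filter (· ∈ E)).card = x + 1 := by
        rw [Finset.range_add_one, Finset.filter_insert, if_pos h,
          Finset.card_insert_of_notMem (by simp)]
      rw [hc, if_pos h, if_pos h, show partialSum (t + 1) ^ (x + 1) * (R * (partialSum (t + 1) * 2))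
          = MvPolynomial.C 2 * (partialSum (t + 1) ^ (x + 2) * R) by
        rw [show (MvPolynomial.C 2 : MvPolynomial ℕ ℚ) = 2 from map_ofNat _ 2]; ring,
        MvPolynomial.coeff_C_mul, coeff_partialSum_pow_mul hR, Nat.add_sub_cancel,
        Nat.cast_choose_two]
      push_cast
      ring
    · have hc : ((Finset.range (t + 1)).filter (· ∈ E)).card = x := by
        rw [Finset.range_add_one, Finset.filter_insert, if_neg h]
      rw [hc, if_neg h, if_neg h, show partialSum (t + 1) ^ x * (R * (partialSum (t + 1) *
          -partialSum t)) = MvPolynomial.C (-1) * (partialSum (t + 1) ^ (x + 1)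
            * (partialSum t * R)) by
        rw [map_neg, map_one]; ring,
        MvPolynomial.coeff_C_mul, coeff_partialSum_pow_mul
          (Subalgebra.mul_mem _ (partialSum_mem_supported le_rfl) hR), Nat.cast_choose_two,
        ← mul_assoc (partialSum t ^ _), ← pow_succ]
      rcases Nat.eq_zero_or_pos x with h0 | h0
      · rw [h0]; simp
      · rw [show x + 1 - 2 + 1 = x by omega]
        push_cast
        ring

theorem coeff_prod_partialSum (n : ℕ) :
    (∏ s ∈ Finset.range n, partialSum (s + 1) * (2 * partialSum n - partialSum s)).coeff
      (doubleExponent n)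
    = subsetSum (fun x => (x + 1) * (x + 2)) (fun x => -(x * (x + 1) / 2)) n := by
  have h : ∏ s ∈ Finset.range n, partialSum (s + 1) * (2 * partialSum n - partialSum s)
      = ∑ E ∈ (Finset.range n).powerset,
        partialSum n ^ ((Finset.range n).filter (· ∈ E)).card * ∏ s ∈ Finset.range n,
          partialSum (s + 1) * (if s ∈ E then 2 else -partialSum s) := by
    rw [Finset.prod_mul_distrib]
    simp only [sub_eq_add_neg, Finset.prod_add, Finset.mul_sum]
    refine Finset.sum_congr rfl fun E hE => ?_
    have hE := Finset.mem_powerset.1 hE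
    have hf : (Finset.range n).filter (· ∈ E) = E := by
      ext x; simp only [Finset.mem_filter]; exact ⟨fun h => h.2, fun h => ⟨hE h, h⟩⟩
    have hs : ∏ s ∈ Finset.range n, (if s ∈ E then 2 else -partialSum s)
        = (∏ s ∈ Finset.range n \ E, -partialSum s) * 2 ^ E.card := by
      rw [← Finset.prod_sdiff hE, ← Finset.prod_const]
      congr 1
      · exact Finset.prod_congr rfl fun s hs => if_neg (Finset.mem_sdiff.1 hs).2
      · exact Finset.prod_congr rfl fun s hs => if_pos hs
    simp only [hf, Finset.prod_mul_distrib, hs, Finset.prod_const]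
    ring
  rw [h, MvPolynomial.coeff_sum, subsetSum]
  exact Finset.sum_congr rfl fun E _ => coeff_dellac_product E n

/-- The possible dots `(c + 1, i)` in the first `n` columns of a symplectic Dellac
configuration of size `2 n` whose row `i` is `k + 1` or its mirror image, listed as `(c, i)`. -/
def rowDots (n k : ℕ) : Finset (ℕ × ℕ) :=
  (Finset.range n ×ˢ {k + 1, 4 * n - k}).filter
    (fun q => q.1 + 1 ≤ q.2 ∧ q.2 ≤ q.1 + 1 + 2 * n)

theorem mem_rowDots {n k : ℕ} {q : ℕ × ℕ} (hk : k < 2 * n) :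
    q ∈ rowDots n k ↔ q.1 < n ∧
      (q.2 = k + 1 ∧ q.1 ≤ k ∨ q.2 = 4 * n - k ∧ 2 * n ≤ q.1 + 1 + k) := by
  simp only [rowDots, Finset.mem_filter, Finset.mem_product, Finset.mem_range, Finset.mem_insert,
    Finset.mem_singleton]
  omega

theorem sum_ite_lt_X {n t : ℕ} (h : t ≤ n) :
    ∑ c ∈ Finset.range n, (if c < t then (MvPolynomial.X c : MvPolynomial ℕ ℚ) else 0)
      = partialSum t := by
  rw [← Finset.sum_filter, partialSum]
  congr 1
  ext c
  simp only [Finset.mem_filter, Finset.mem_range]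
  omega

theorem sum_rowDots {n k : ℕ} (hk : k < 2 * n) :
    ∑ q ∈ rowDots n k, (MvPolynomial.X q.1 : MvPolynomial ℕ ℚ)
      = if k < n then partialSum (k + 1) else 2 * partialSum n - partialSum (2 * n - 1 - k) := by
  rw [rowDots, Finset.sum_filter, Finset.sum_product]
  have hpair : ∀ c ∈ Finset.range n, ∑ i ∈ ({k + 1, 4 * n - k} : Finset ℕ),
      (if c + 1 ≤ i ∧ i ≤ c + 1 + 2 * n then (MvPolynomial.X c : MvPolynomial ℕ ℚ) else 0)
      = (if c < k + 1 then MvPolynomial.X c else 0)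
        + (MvPolynomial.X c - if c < 2 * n - 1 - k then MvPolynomial.X c else 0) := by
    intro c hc
    have hc := Finset.mem_range.1 hc
    rw [Finset.sum_pair (by omega)]
    congr 1
    · exact if_congr (by omega) rfl rfl
    · by_cases h : c < 2 * n - 1 - k
      · rw [if_neg (by omega), if_pos h, sub_self]
      · rw [if_pos (by omega), if_neg h, sub_zero]
  rw [Finset.sum_congr rfl hpair, Finset.sum_add_distrib, Finset.sum_sub_distrib]
  split_ifs with h
  · rw [sum_ite_lt_X h, add_eq_left, ← Finset.sum_sub_distrib]
    refine Finset.sum_eq_zero fun c hc => ?_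
    have := Finset.mem_range.1 hc
    rw [if_pos (by omega), sub_self]
  · have hfull : ∑ c ∈ Finset.range n,
        (if c < k + 1 then (MvPolynomial.X c : MvPolynomial ℕ ℚ) else 0) = partialSum n := by
      refine Finset.sum_congr rfl fun c hc => if_pos ?_
      have := Finset.mem_range.1 hc
      omega
    rw [hfull, sum_ite_lt_X (by omega), ← partialSum]
    ring

theorem prod_sum_rowDots (n : ℕ) :
    ∏ k : Fin (2 * n), ∑ q ∈ rowDots n k, (MvPolynomial.X q.1 : MvPolynomial ℕ ℚ)
      = ∏ s ∈ Finset.range n, partialSum (s + 1) * (2 * partialSum n - partialSum s) := by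
  rw [← Finset.prod_range (fun k => ∑ q ∈ rowDots n k, (MvPolynomial.X q.1 : MvPolynomial ℕ ℚ)),
    Finset.prod_congr rfl fun k hk => sum_rowDots (Finset.mem_range.1 hk), two_mul,
    Finset.prod_range_add, Finset.prod_mul_distrib]
  congr 1
  · exact Finset.prod_congr rfl fun k hk => if_pos (Finset.mem_range.1 hk)
  · rw [← Finset.prod_range_reflect]
    refine Finset.prod_congr rfl fun s hs => ?_
    have := Finset.mem_range.1 hs
    rw [if_neg (by omega), show n + n - 1 - (n + (n - 1 - s)) = s by omega, two_mul]

/-- The choices of one dot in each pair of mirror rows, with two dots in each of the first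
`n` columns. -/
def halfConfigs (n : ℕ) : Finset (Fin (2 * n) → ℕ × ℕ) :=
  (Fintype.piFinset (fun k : Fin (2 * n) => rowDots n k)).filter
    (fun p => ∀ c < n, (Finset.univ.filter (fun k => (p k).1 = c)).card = 2)

theorem card_halfConfigs (n : ℕ) :
    ((halfConfigs n).card : ℚ)
      = (∏ k : Fin (2 * n), ∑ q ∈ rowDots n k,
        (MvPolynomial.X q.1 : MvPolynomial ℕ ℚ)).coeff (doubleExponent n) := by
  rw [Finset.prod_univ_sum, MvPolynomial.coeff_sum, halfConfigs, Finset.card_filter, Nat.cast_sum]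
  refine Finset.sum_congr rfl fun p hp => ?_
  have hmon : ∏ k, (MvPolynomial.X (p k).1 : MvPolynomial ℕ ℚ)
      = MvPolynomial.monomial (∑ k, Finsupp.single (p k).1 1) 1 :=
    (MvPolynomial.monomial_sum_one _ _).symm
  rw [hmon, MvPolynomial.coeff_monomial, Nat.cast_ite, Nat.cast_one, Nat.cast_zero]
  refine if_congr ?_ rfl rfl
  have happ : ∀ c, (∑ k, Finsupp.single (p k).1 1 : ℕ →₀ ℕ) c
      = (Finset.univ.filter (fun k => (p k).1 = c)).card := by
    intro c
    rw [Finsupp.finsetSum_apply, Finset.card_filter]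
    exact Finset.sum_congr rfl fun k _ => Finsupp.single_apply
  rw [Finsupp.ext_iff]
  simp only [happ, doubleExponent_apply]
  constructor
  · intro h c
    split_ifs with hc
    · exact h c hc
    · rw [Finset.card_eq_zero, Finset.filter_eq_empty_iff]
      intro k _ hk
      have := ((mem_rowDots k.2).1 (Fintype.mem_piFinset.1 hp k)).1
      omega
  · intro h c hc
    rw [h c, if_pos hc]

/-- The centrally symmetric set of dots generated by a choice of dots in the first columns. -/
def symmetricConfig (n : ℕ) (p : Fin (2 * n) → ℕ × ℕ) : Finset (ℕ × ℕ) :=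
  Finset.univ.image (fun k => ((p k).1 + 1, (p k).2)) ∪
    Finset.univ.image (fun k => (2 * n - (p k).1, 4 * n + 1 - (p k).2))

theorem mem_symmetricConfig {n : ℕ} {p : Fin (2 * n) → ℕ × ℕ} {d : ℕ × ℕ} :
    d ∈ symmetricConfig n p ↔ (∃ k, d.1 = (p k).1 + 1 ∧ d.2 = (p k).2) ∨
      ∃ k, d.1 = 2 * n - (p k).1 ∧ d.2 = 4 * n + 1 - (p k).2 := by
  simp only [symmetricConfig, Finset.mem_union, Finset.mem_image, Finset.mem_univ, true_and,
    Prod.ext_iff, eq_comm]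

section

variable {n : ℕ} {p : Fin (2 * n) → ℕ × ℕ}

theorem card_column_left (hp : ∀ k : Fin (2 * n), p k ∈ rowDots n k) {c : ℕ} (hc : c < n) :
    ((symmetricConfig n p).filter (fun d => d.1 = c + 1)).card
      = (Finset.univ.filter (fun k => (p k).1 = c)).card := by
  symm
  refine Finset.card_bij (fun k _ => ((p k).1 + 1, (p k).2)) ?_ ?_ ?_
  · intro k hk
    rw [Finset.mem_filter] at hk ⊢
    exact ⟨mem_symmetricConfig.2 (Or.inl ⟨k, rfl, rfl⟩), by simp [hk.2]⟩
  · intro k _ k' _ h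
    have h₁ := (mem_rowDots k.2).1 (hp k)
    have h₂ := (mem_rowDots k'.2).1 (hp k')
    have := (Prod.ext_iff.1 h).2
    simp only at this
    apply Fin.ext
    omega
  · intro d hd
    obtain ⟨hd, hdc⟩ := Finset.mem_filter.1 hd
    rcases mem_symmetricConfig.1 hd with ⟨k, h₁, h₂⟩ | ⟨k, h₁, h₂⟩
    · refine ⟨k, ?_, Prod.ext h₁.symm h₂.symm⟩
      rw [Finset.mem_filter]
      exact ⟨Finset.mem_univ _, by omega⟩
    · have := (mem_rowDots k.2).1 (hp k)
      omega

theorem card_column_right (hp : ∀ k : Fin (2 * n), p k ∈ rowDots n k) {c : ℕ} (hc : c < n) :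
    ((symmetricConfig n p).filter (fun d => d.1 = 2 * n - c)).card
      = (Finset.univ.filter (fun k => (p k).1 = c)).card := by
  symm
  refine Finset.card_bij (fun k _ => (2 * n - (p k).1, 4 * n + 1 - (p k).2)) ?_ ?_ ?_
  · intro k hk
    rw [Finset.mem_filter] at hk ⊢
    exact ⟨mem_symmetricConfig.2 (Or.inr ⟨k, rfl, rfl⟩), by simp [hk.2]⟩
  · intro k _ k' _ h
    have h₁ := (mem_rowDots k.2).1 (hp k)
    have h₂ := (mem_rowDots k'.2).1 (hp k')
    have := (Prod.ext_iff.1 h).2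
    simp only at this
    apply Fin.ext
    omega
  · intro d hd
    obtain ⟨hd, hdc⟩ := Finset.mem_filter.1 hd
    rcases mem_symmetricConfig.1 hd with ⟨k, h₁, h₂⟩ | ⟨k, h₁, h₂⟩
    · have := (mem_rowDots k.2).1 (hp k)
      omega
    · have := (mem_rowDots k.2).1 (hp k)
      refine ⟨k, ?_, Prod.ext h₁.symm h₂.symm⟩
      rw [Finset.mem_filter]
      exact ⟨Finset.mem_univ _, by omega⟩

theorem card_row_symmetricConfig (hp : ∀ k : Fin (2 * n), p k ∈ rowDots n k) {i : ℕ} (h₁ : 1 ≤ i)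
    (h₂ : i ≤ 4 * n) : ((symmetricConfig n p).filter (fun d => d.2 = i)).card = 1 := by
  obtain ⟨k, hk⟩ : ∃ k : Fin (2 * n), i = (k : ℕ) + 1 ∨ i = 4 * n - k := by
    by_cases h : i ≤ 2 * n
    · exact ⟨⟨i - 1, by omega⟩, Or.inl (by simp only; omega)⟩
    · exact ⟨⟨4 * n - i, by omega⟩, Or.inr (by simp only; omega)⟩
  have hpk := (mem_rowDots k.2).1 (hp k)
  have huniq : ∀ k' : Fin (2 * n), (p k').2 = i ∨ 4 * n + 1 - (p k').2 = i → k' = k := by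
    intro k' hk'
    have := (mem_rowDots k'.2).1 (hp k')
    apply Fin.ext
    omega
  rw [Finset.card_eq_one]
  by_cases h : (p k).2 = i
  · refine ⟨((p k).1 + 1, (p k).2), Finset.eq_singleton_iff_unique_mem.2 ⟨?_, ?_⟩⟩
    · exact Finset.mem_filter.2 ⟨mem_symmetricConfig.2 (Or.inl ⟨k, rfl, rfl⟩), h⟩
    · intro d hd
      obtain ⟨hd, hdi⟩ := Finset.mem_filter.1 hd
      rcases mem_symmetricConfig.1 hd with ⟨k', h₃, h₄⟩ | ⟨k', h₃, h₄⟩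
      · obtain rfl := huniq k' (Or.inl (by omega))
        exact Prod.ext h₃ h₄
      · obtain rfl := huniq k' (Or.inr (by omega))
        omega
  · refine ⟨(2 * n - (p k).1, 4 * n + 1 - (p k).2),
      Finset.eq_singleton_iff_unique_mem.2 ⟨?_, ?_⟩⟩
    · refine Finset.mem_filter.2 ⟨mem_symmetricConfig.2 (Or.inr ⟨k, rfl, rfl⟩), ?_⟩
      have := k.2
      simp only
      omega
    · intro d hd
      obtain ⟨hd, hdi⟩ := Finset.mem_filter.1 hd
      rcases mem_symmetricConfig.1 hd with ⟨k', h₃, h₄⟩ | ⟨k', h₃, h₄⟩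
      · obtain rfl := huniq k' (Or.inl (by omega))
        omega
      · obtain rfl := huniq k' (Or.inr (by omega))
        exact Prod.ext h₃ h₄

theorem mirror_mem_symmetricConfig (hp : ∀ k : Fin (2 * n), p k ∈ rowDots n k) {j i : ℕ}
    (h : (j, i) ∈ symmetricConfig n p) :
    (2 * n + 1 - j, 4 * n + 1 - i) ∈ symmetricConfig n p := by
  rw [mem_symmetricConfig] at h ⊢
  simp only at h ⊢
  rcases h with ⟨k, h₁, h₂⟩ | ⟨k, h₁, h₂⟩
  · exact Or.inr ⟨k, by omega, by omega⟩
  · have := (mem_rowDots k.2).1 (hp k)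
    have := k.2
    exact Or.inl ⟨k, by omega, by omega⟩

theorem isSpDC_symmetricConfig (hp : ∀ k : Fin (2 * n), p k ∈ rowDots n k)
    (hc : ∀ c < n, (Finset.univ.filter (fun k => (p k).1 = c)).card = 2) :
    IsSpDC n (symmetricConfig n p) := by
  have hdot : ∀ d ∈ symmetricConfig n p, 1 ≤ d.1 ∧ d.1 ≤ 2 * n ∧ 1 ≤ d.2 ∧ d.2 ≤ 4 * n ∧
      d.1 ≤ d.2 ∧ d.2 ≤ d.1 + 2 * n := by
    intro d hd
    rcases mem_symmetricConfig.1 hd with ⟨k, h₁, h₂⟩ | ⟨k, h₁, h₂⟩ <;>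
    · have := (mem_rowDots k.2).1 (hp k)
      have := k.2
      omega
  refine ⟨⟨?_, ?_, ?_, ?_⟩, ?_⟩
  · intro d hd
    have := hdot d hd
    omega
  · intro i h₁ h₂
    exact card_row_symmetricConfig hp h₁ (by omega)
  · intro j h₁ h₂
    by_cases h : j ≤ n
    · rw [← hc (j - 1) (by omega), ← card_column_left hp (by omega), Nat.sub_add_cancel h₁]
    · rw [← hc (2 * n - j) (by omega), ← card_column_right hp (by omega),
        show 2 * n - (2 * n - j) = j by omega]
  · intro d hd
    have := hdot d hd
    omega
  · intro j i h₁ h₂ h₃ h₄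
    refine ⟨mirror_mem_symmetricConfig hp, fun h => ?_⟩
    have := mirror_mem_symmetricConfig hp h
    rwa [show 2 * n + 1 - (2 * n + 1 - j) = j by omega,
      show 4 * n + 1 - (4 * n + 1 - i) = i by omega] at this

end

theorem exists_halfConfig {n : ℕ} {S : Finset (ℕ × ℕ)} (hS : IsSpDC n S) :
    ∃ p ∈ halfConfigs n, symmetricConfig n p = S := by
  obtain ⟨⟨hb, hrow, hcol, hd⟩, hsym⟩ := hS
  have hmirror : ∀ j i, (j, i) ∈ S → (2 * n + 1 - j, 4 * n + 1 - i) ∈ S := by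
    intro j i h
    have := hb _ h
    exact (hsym j i (by omega) (by omega) (by omega) (by omega)).1 h
  have hex : ∀ k : Fin (2 * n), ∃ q ∈ rowDots n k, (q.1 + 1, q.2) ∈ S := by
    intro k
    have hk := k.2
    obtain ⟨d, hdS⟩ := Finset.card_pos.1 ((hrow (k + 1) (by omega) (by omega)).symm ▸ one_pos)
    obtain ⟨hdS, hdk⟩ := Finset.mem_filter.1 hdS
    obtain ⟨j, i⟩ := d
    have h₁ := hb _ hdS
    have h₂ := hd _ hdS
    simp only at h₁ h₂ hdk
    by_cases h : j ≤ n
    · refine ⟨(j - 1, i), (mem_rowDots hk).2 ⟨by simp only; omega, Or.inl ?_⟩, ?_⟩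
      · simp only; omega
      · simpa [Nat.sub_add_cancel h₁.1] using hdS
    · refine ⟨(2 * n - j, 4 * n + 1 - i), (mem_rowDots hk).2 ⟨by simp only; omega, Or.inr ?_⟩, ?_⟩
      · simp only; omega
      · have := hmirror j i hdS
        rwa [show 2 * n + 1 - j = 2 * n - j + 1 by omega] at this
  choose p hp hpS using hex
  have hpS' : ∀ k, (2 * n - (p k).1, 4 * n + 1 - (p k).2) ∈ S := by
    intro k
    have := hmirror _ _ (hpS k)
    rwa [show 2 * n + 1 - ((p k).1 + 1) = 2 * n - (p k).1 by omega] at this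
  have hunique : ∀ d ∈ S, ∀ d' ∈ S, d.2 = d'.2 → d = d' := by
    intro d hdS d' hdS' h
    have := hb _ hdS'
    exact Finset.card_le_one.1 (hrow d'.2 (by omega) (by omega)).le d
      (Finset.mem_filter.2 ⟨hdS, h⟩) d' (Finset.mem_filter.2 ⟨hdS', rfl⟩)
  have heq : symmetricConfig n p = S := by
    ext d
    constructor
    · intro h
      rcases mem_symmetricConfig.1 h with ⟨k, h₁, h₂⟩ | ⟨k, h₁, h₂⟩
      · rw [show d = ((p k).1 + 1, (p k).2) from Prod.ext h₁ h₂]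
        exact hpS k
      · rw [show d = (2 * n - (p k).1, 4 * n + 1 - (p k).2) from Prod.ext h₁ h₂]
        exact hpS' k
    · intro h
      have := hb _ h
      obtain ⟨d', hd'⟩ := Finset.card_pos.1
        ((card_row_symmetricConfig hp (i := d.2) (by omega) (by omega)).symm ▸ one_pos)
      obtain ⟨hd', hi⟩ := Finset.mem_filter.1 hd'
      have hd'S : d' ∈ S := by
        rcases mem_symmetricConfig.1 hd' with ⟨k, h₁, h₂⟩ | ⟨k, h₁, h₂⟩
        · rw [show d' = ((p k).1 + 1, (p k).2) from Prod.ext h₁ h₂]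
          exact hpS k
        · rw [show d' = (2 * n - (p k).1, 4 * n + 1 - (p k).2) from Prod.ext h₁ h₂]
          exact hpS' k
      rwa [hunique d h d' hd'S hi.symm]
  refine ⟨p, Finset.mem_filter.2 ⟨Fintype.mem_piFinset.2 hp, fun c hc => ?_⟩, heq⟩
  rw [← card_column_left hp hc, heq]
  exact hcol (c + 1) (by omega) (by omega)

theorem ncard_SpDC (n : ℕ) : (SpDC n).ncard = (halfConfigs n).card := by
  rw [← Set.ncard_coe_finset]
  symm
  refine Set.ncard_congr (fun p _ => symmetricConfig n p) ?_ ?_ ?_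
  · intro p hp
    obtain ⟨hp, hc⟩ := Finset.mem_filter.1 (Finset.mem_coe.1 hp)
    exact isSpDC_symmetricConfig (Fintype.mem_piFinset.1 hp) hc
  · intro p q hp hq h
    have hp := Fintype.mem_piFinset.1 (Finset.mem_filter.1 (Finset.mem_coe.1 hp)).1
    have hq := Fintype.mem_piFinset.1 (Finset.mem_filter.1 (Finset.mem_coe.1 hq)).1
    funext k
    have hk : ((p k).1 + 1, (p k).2) ∈ symmetricConfig n q :=
      h ▸ mem_symmetricConfig.2 (Or.inl ⟨k, rfl, rfl⟩)
    have h₁ := (mem_rowDots k.2).1 (hp k)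
    rcases mem_symmetricConfig.1 hk with ⟨k', h₂, h₃⟩ | ⟨k', h₂, h₃⟩
    · have h₄ := (mem_rowDots k'.2).1 (hq k')
      simp only at h₂ h₃
      obtain rfl : k' = k := Fin.ext (by omega)
      exact Prod.ext (by omega) h₃
    · have h₄ := (mem_rowDots k'.2).1 (hq k')
      simp only at h₂ h₃
      omega
  · intro S hS
    obtain ⟨p, hp, h⟩ := exists_halfConfig hS
    exact ⟨p, Finset.mem_coe.2 hp, h⟩

/-- For every `n ≥ 1`, `#SpDC_{2n} = Σ_{f ∈ SP_n} 2^{ndf(f)}`. -/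
theorem spdc_card_eq_sum_sp (n : ℕ) (hn : 1 ≤ n) :
    (SpDC n).ncard = ∑ᶠ f ∈ SP n, 2 ^ ndf n f := by
  have h : (((SpDC n).ncard : ℕ) : ℚ) = ((∑ᶠ f ∈ SP n, 2 ^ ndf n f : ℕ) : ℚ) := by
    rw [finsum_two_pow_ndf n hn, ← subsetSum_dellac_eq_pistol n hn, ncard_SpDC, card_halfConfigs,
      prod_sum_rowDots, coeff_prod_partialSum]
  exact_mod_cast h
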